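/- If an equation system S contains equations U =? X*Y and V =? g(Z) with U ∼ V, then S has no E₀-unifier. -/

import Mathlib

/-- Terms built from variables, free constants, two multiplication symbols
`mul` (*) and `cmul` (⊛), a binary symbol `exp`, and a unary symbol `g`. -/
inductive Tm : Type
  | var : ℕ → Tm
  | const : ℕ → Tm
  | mul : Tm → Tm → Tm
  | cmul : Tm → Tm → Tm
  | exp : Tm → Tm → Tm
  | g : Tm → Tm

/-- The equational theory E₀: the smallest congruence on terms, closed under
substitution (hence the axioms are stated for arbitrary terms), generated by
`exp(g(X),Y) = g(X ⊛ Y)` and `exp(X*Y,Z) = exp(X,Z) * exp(Y,Z)`. -/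
inductive E0 : Tm → Tm → Prop
  | ax1 (x y : Tm) : E0 (.exp (.g x) y) (.g (.cmul x y))
  | ax2 (x y z : Tm) : E0 (.exp (.mul x y) z) (.mul (.exp x z) (.exp y z))
  | refl (t : Tm) : E0 t t
  | symm {s t : Tm} : E0 s t → E0 t s
  | trans {s t u : Tm} : E0 s t → E0 t u → E0 s u
  | mul_congr {a b c d : Tm} : E0 a b → E0 c d → E0 (.mul a c) (.mul b d)
  | cmul_congr {a b c d : Tm} : E0 a b → E0 c d → E0 (.cmul a c) (.cmul b d)
  | exp_congr {a b c d : Tm} : E0 a b → E0 c d → E0 (.exp a c) (.exp b d)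
  | g_congr {a b : Tm} : E0 a b → E0 (.g a) (.g b)

/-- A ground term contains no variables. -/
def Tm.Ground : Tm → Prop
  | .var _ => False
  | .const _ => True
  | .mul s t => s.Ground ∧ t.Ground
  | .cmul s t => s.Ground ∧ t.Ground
  | .exp s t => s.Ground ∧ t.Ground
  | .g t => t.Ground


/-- Flat right-hand sides of equations: a variable, or `g(V)`, `exp(V,W)`,
`V*W`, `V⊛W` with `V`, `W` variables. -/
inductive Flat : Type
  | var : ℕ → Flat
  | g : ℕ → Flat
  | exp : ℕ → ℕ → Flat
  | mul : ℕ → ℕ → Flat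
  | cmul : ℕ → ℕ → Flat
deriving DecidableEq

/-- An equation `U =? t` is a pair of a variable and a flat term. -/
abbrev Eqn : Type := ℕ × Flat

/-- An equation system is a finite set of equations. -/
abbrev Sys : Type := Finset Eqn

/-- Interpretation of a flat term under a substitution. -/
def Flat.toTm (σ : ℕ → Tm) : Flat → Tm
  | .var v => σ v
  | .g v => .g (σ v)
  | .exp v w => .exp (σ v) (σ w)
  | .mul v w => .mul (σ v) (σ w)
  | .cmul v w => .cmul (σ v) (σ w)

/-- `σ` is an E₀-unifier of `S` iff `σ(U) =_{E₀} σ(t)` for each `U =? t` in `S`. -/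
def IsUnifier (σ : ℕ → Tm) (S : Sys) : Prop :=
  ∀ e ∈ S, E0 (σ e.1) (Flat.toTm σ e.2)

/-- The variables occurring in a flat term. -/
def Flat.vars : Flat → Finset ℕ
  | .var v => {v}
  | .g v => {v}
  | .exp v w => {v, w}
  | .mul v w => {v, w}
  | .cmul v w => {v, w}

/-- A flat term is a non-variable term. -/
def Flat.NonVar : Flat → Prop
  | .var _ => False
  | _ => True

/-- `U ≻ V` iff `S` contains an equation `U =? t` with `t` a non-variable term
containing `V`. -/
def Succ (S : Sys) (U V : ℕ) : Prop :=
  ∃ t : Flat, (U, t) ∈ S ∧ t.NonVar ∧ V ∈ t.vars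

/-- `U ≻_b V` iff `S` contains an equation `U =? exp(V,W)`. -/
def SuccB (S : Sys) (U V : ℕ) : Prop :=
  ∃ W, (U, Flat.exp V W) ∈ S

/-- `U ≻_m V` iff `S` contains an equation `U =? V*W` or `U =? W*V`. -/
def SuccM (S : Sys) (U V : ℕ) : Prop :=
  ∃ W, (U, Flat.mul V W) ∈ S ∨ (U, Flat.mul W V) ∈ S

/-- `∼` is the reflexive-symmetric-transitive closure of `≻_b`. -/
def Sim (S : Sys) : ℕ → ℕ → Prop :=
  Relation.EqvGen (SuccB S)

/-- The outermost symbol of a term once exponents are stripped: `some true` for `*`,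
`some false` for `g`, and `none` otherwise. -/
def Tm.baseHead : Tm → Option Bool
  | .var _ => none
  | .const _ => none
  | .mul _ _ => some true
  | .cmul _ _ => none
  | .exp s _ => s.baseHead
  | .g _ => some false

theorem E0.baseHead_eq {s t : Tm} (h : E0 s t) : s.baseHead = t.baseHead := by
  induction h with
  | symm _ ih => exact ih.symm
  | trans _ _ ih₁ ih₂ => exact ih₁.trans ih₂
  | exp_congr _ _ ih _ => exact ih
  | _ => rfl

theorem IsUnifier.baseHead_eq_of_sim {σ : ℕ → Tm} {S : Sys} (hσ : IsUnifier σ S) {U V : ℕ}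
    (h : Sim S U V) : (σ U).baseHead = (σ V).baseHead := by
  induction h with
  | rel _ _ h =>
    obtain ⟨_, hW⟩ := h
    exact (hσ _ hW).baseHead_eq
  | refl _ => rfl
  | symm _ _ _ ih => exact ih.symm
  | trans _ _ _ _ _ ih₁ ih₂ => exact ih₁.trans ih₂

/-- If `S` contains equations `U =? X*Y` and `V =? g(Z)` with `U ∼ V`, then `S`
has no E₀-unifier. -/
theorem no_unifier_of_mul_g_sim (S : Sys) (U V X Y Z : ℕ)
    (h1 : (U, Flat.mul X Y) ∈ S) (h2 : (V, Flat.g Z) ∈ S) (h3 : Sim S U V) :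
    ¬ ∃ σ : ℕ → Tm, IsUnifier σ S := by
  rintro ⟨σ, hσ⟩
  have hU : (σ U).baseHead = some true := (hσ _ h1).baseHead_eq
  have hV : (σ V).baseHead = some false := (hσ _ h2).baseHead_eq
  have hUV := hσ.baseHead_eq_of_sim h3
  simp [hU, hV] at hUV
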